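/- Let ξ ∈ (−2,2), let (ξ_N)_{N∈ℕ} be a sequence of real numbers with lim_{N→∞} ξ_N/√N = ξ, and let η ∈ ℂ. Then for every l ∈ ℕ: lim_{N→∞} [ ((−1)^l·η^{2l})/(l!·N^{l+1/2}) · (1/(2πi)) ∮_{γ_N} exp(−(1/4)·ξ_N²·(1−z)) / (1−z)^{l+3/2} · dz/z^{N+1} ] = (1/√π) · ((−1)^l·η^{2l})/((2l+1)!) · (4−ξ²)^{l+1/2}, where γ_N is the counterclockwise circle of radius 1 − 1/N around the origin and (1−z)^{l+3/2} denotes the principal branch. -/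

import Mathlib

open MeasureTheory Filter Nat

noncomputable section

lemma aux_integrable (s p : ℝ) (hs : 0 < s) (hp : 0 < p) :
    IntegrableOn (fun t : ℝ => t ^ (s - 1) * Real.exp (-(p * t))) (Set.Ioi 0) := by
  have := integrableOn_rpow_mul_exp_neg_mul_rpow (p := 1) (s := s - 1) (b := p) (by linarith) one_pos hp
  simpa [neg_mul] using this

lemma aux_laplace (s : ℝ) (hs : 0 < s) (p : ℂ) (hp : 0 < p.re) :
    ∫ t : ℝ in Set.Ioi 0, ((t ^ (s - 1) : ℝ) : ℂ) * Complex.exp (-(p * t)) =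
      (Real.Gamma s : ℂ) * p ^ (-(s : ℂ)) := by
  have hmeas : ∀ (a : ℝ) (q : ℂ), AEStronglyMeasurable
      (fun t : ℝ => ((t ^ a : ℝ) : ℂ) * Complex.exp (-(q * t))) (volume.restrict (Set.Ioi 0)) := by
    intro a q
    apply Measurable.aestronglyMeasurable
    fun_prop
  have hnorm : ∀ (a : ℝ) (q : ℂ) (t : ℝ), 0 < t →
      ‖((t ^ a : ℝ) : ℂ) * Complex.exp (-(q * t))‖ = t ^ a * Real.exp (-(q.re * t)) := by
    intro a q t ht
    rw [norm_mul, Complex.norm_exp, Complex.norm_real, Real.norm_of_nonneg (by positivity)]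
    simp
  have hint : ∀ (a : ℝ) (q : ℂ), 0 < a → 0 < q.re → Integrable
      (fun t : ℝ => ((t ^ (a - 1) : ℝ) : ℂ) * Complex.exp (-(q * t)))
      (volume.restrict (Set.Ioi 0)) := by
    intro a q ha hq
    refine (aux_integrable a q.re ha hq).mono' (hmeas _ _) ?_
    filter_upwards [ae_restrict_mem measurableSet_Ioi] with t ht
    exact (hnorm _ _ _ ht).le
  have hopen : IsOpen {p : ℂ | 0 < p.re} := isOpen_lt continuous_const Complex.continuous_re
  have hL : DifferentiableOn ℂ (fun p : ℂ => ∫ t : ℝ in Set.Ioi 0,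
      ((t ^ (s - 1) : ℝ) : ℂ) * Complex.exp (-(p * t))) {p : ℂ | 0 < p.re} := by
    intro q hq
    have hq : 0 < q.re := hq
    refine DifferentiableAt.differentiableWithinAt ?_
    have hnb : {p : ℂ | q.re / 2 < p.re} ∈ nhds q :=
      (isOpen_lt continuous_const Complex.continuous_re).mem_nhds (by
        show q.re / 2 < q.re
        linarith)
    refine (hasDerivAt_integral_of_dominated_loc_of_deriv_le
      (F := fun (p : ℂ) (t : ℝ) => ((t ^ (s - 1) : ℝ) : ℂ) * Complex.exp (-(p * t)))
      (F' := fun (p : ℂ) (t : ℝ) => -(((t ^ s : ℝ) : ℂ) * Complex.exp (-(p * t))))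
      (bound := fun t => t ^ ((s + 1) - 1) * Real.exp (-(q.re / 2 * t))) hnb
      (Eventually.of_forall fun p => hmeas _ _) (hint s q hs hq) (hmeas _ _).neg ?_
      (aux_integrable (s + 1) (q.re / 2) (by linarith) (by linarith)) ?_).2.differentiableAt
    · filter_upwards [ae_restrict_mem measurableSet_Ioi] with t ht p hp
      have ht : 0 < t := ht
      have hp : q.re / 2 < p.re := hp
      rw [norm_neg, hnorm _ _ _ ht, add_sub_cancel_right]
      gcongr
    · filter_upwards [ae_restrict_mem measurableSet_Ioi] with t ht p hp
      have ht : 0 < t := ht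
      have h1 : HasDerivAt (fun p : ℂ => -(p * t)) (-(1 * (t : ℂ))) p :=
        ((hasDerivAt_id p).mul_const (t : ℂ)).neg
      have h2 := h1.cexp.const_mul (((t ^ (s - 1) : ℝ) : ℂ))
      refine h2.congr_deriv ?_
      have : t ^ s = t ^ (s - 1) * t := by
        rw [← Real.rpow_add_one ht.ne']; simp
      rw [this]; push_cast; ring
  have hR : DifferentiableOn ℂ (fun p : ℂ => (Real.Gamma s : ℂ) * p ^ (-(s : ℂ)))
      {p : ℂ | 0 < p.re} := by
    intro q hq
    refine DifferentiableAt.differentiableWithinAt ?_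
    refine DifferentiableAt.const_mul ?_ _
    exact (differentiableAt_id).cpow_const (Or.inl hq)
  have hreal : ∀ r : ℝ, 0 < r → ∫ t : ℝ in Set.Ioi 0,
      ((t ^ (s - 1) : ℝ) : ℂ) * Complex.exp (-((r : ℂ) * t)) =
      (Real.Gamma s : ℂ) * (r : ℂ) ^ (-(s : ℂ)) := by
    intro r hr
    have := Real.integral_rpow_mul_exp_neg_mul_Ioi hs hr
    have h2 : (Real.Gamma s : ℂ) * (r : ℂ) ^ (-(s : ℂ)) = (((1 / r) ^ s * Real.Gamma s : ℝ) : ℂ) := by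
      rw [← Complex.ofReal_neg, ← Complex.ofReal_cpow hr.le, one_div, Real.inv_rpow hr.le,
        Real.rpow_neg hr.le]
      push_cast; ring
    rw [h2, ← this, ← integral_complex_ofReal]
    congr 1
    ext t
    push_cast
    rfl
  have hpre : IsPreconnected {p : ℂ | 0 < p.re} :=
    (convex_halfSpace_re_gt 0).isPreconnected
  have := (hL.analyticOnNhd hopen).eqOn_of_preconnected_of_frequently_eq (hR.analyticOnNhd hopen)
    hpre (z₀ := 1) (by simp) ?_
  · exact this hp
  · have hu : Tendsto (fun n : ℕ => ((1 + 1 / ((n : ℝ) + 1) : ℝ) : ℂ)) atTop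
        (nhdsWithin 1 {(1 : ℂ)}ᶜ) := by
      rw [tendsto_nhdsWithin_iff]
      constructor
      · have := (tendsto_one_div_add_atTop_nhds_zero_nat (𝕜 := ℝ)).const_add 1
        have := (Complex.continuous_ofReal.tendsto _).comp this
        simpa [Function.comp_def] using this
      · refine Eventually.of_forall fun n => ?_
        simp only [Set.mem_compl_iff, Set.mem_singleton_iff]
        rw [← Complex.ofReal_one, Complex.ofReal_inj]
        have : 0 < 1 / ((n : ℝ) + 1) := by positivity
        linarith
    refine hu.frequently (Frequently.of_forall fun n => ?_)
    exact hreal _ (by positivity)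

lemma aux_bound_integrable (s : ℝ) (hs : 1 < s) :
    Integrable (fun y : ℝ => (1 + y ^ 2) ^ (-s / 2)) := by
  have := integrable_rpow_neg_one_add_norm_sq (E := ℝ) (μ := volume) (r := s) (by simpa using hs)
  simpa using this

lemma aux_norm (s y : ℝ) : ‖(1 - y * Complex.I : ℂ) ^ (-(s : ℂ))‖ = (1 + y ^ 2) ^ (-s / 2) := by
  rw [← Complex.ofReal_neg, Complex.norm_cpow_real]
  have : ‖(1 - y * Complex.I : ℂ)‖ = Real.sqrt (1 + y ^ 2) := by
    rw [Complex.norm_def, Complex.normSq_apply]; simp; ring_nf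
  rw [this, Real.sqrt_eq_rpow, ← Real.rpow_mul (by positivity)]
  ring_nf

lemma aux_cont (s : ℝ) : Continuous fun y : ℝ => (1 - y * Complex.I : ℂ) ^ (-(s : ℂ)) := by
  refine Continuous.cpow (by fun_prop) (by fun_prop) ?_
  intro y
  left; simp

open FourierTransform in
lemma aux_hankel (s c : ℝ) (hs : 1 < s) (hc : 0 < c) :
    ∫ y : ℝ, Complex.exp (c * (1 - y * Complex.I)) * (1 - y * Complex.I : ℂ) ^ (-(s : ℂ)) =
      ((2 * Real.pi * c ^ (s - 1) / Real.Gamma s : ℝ) : ℂ) := by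
  set f : ℝ → ℂ := fun t => (((max t 0) ^ (s - 1) * Real.exp (-t) : ℝ) : ℂ) with hf
  have hfc : Continuous f := by
    have : Continuous fun t : ℝ => (max t 0) ^ (s - 1) :=
      Continuous.rpow_const (by fun_prop) (fun t => Or.inr (by linarith))
    fun_prop
  have hf0 : ∀ t, t ∉ Set.Ioi (0 : ℝ) → f t = 0 := by
    intro t ht
    simp only [Set.mem_Ioi, not_lt] at ht
    simp [hf, max_eq_right ht, Real.zero_rpow (by linarith : s - 1 ≠ 0)]
  have hfi : Integrable f := by
    have h1 : IntegrableOn f (Set.Ioi 0) := by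
      refine IntegrableOn.congr_fun (f := fun t : ℝ => ((t ^ (s - 1) * Real.exp (-(1 * t)) : ℝ) : ℂ))
        (aux_integrable s 1 (by linarith) one_pos).ofReal ?_ measurableSet_Ioi
      intro t ht
      have ht : 0 < t := ht
      simp [hf, max_eq_left ht.le]
    rwa [integrableOn_iff_integrable_of_support_subset] at h1
    intro t ht
    by_contra h
    exact ht (hf0 t h)
  have hF : 𝓕 f = fun y : ℝ => (Real.Gamma s : ℂ) *
      (1 - ((-2 * Real.pi * y : ℝ) : ℂ) * Complex.I) ^ (-(s : ℂ)) := by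
    ext y
    rw [Real.fourier_real_eq_integral_exp_smul, ← aux_laplace s (by linarith) _ (by simp),
      ← setIntegral_eq_integral_of_forall_compl_eq_zero (s := Set.Ioi 0)
        (fun t ht => by simp [hf0 t ht])]
    refine setIntegral_congr_fun measurableSet_Ioi fun t ht => ?_
    have ht : 0 < t := ht
    simp only [hf, max_eq_left ht.le, smul_eq_mul, Complex.ofReal_mul, Complex.ofReal_exp]
    rw [mul_left_comm, ← Complex.exp_add]
    congr 2
    push_cast; ring
  have hGi : Integrable (fun y : ℝ => (Real.Gamma s : ℂ) * (1 - y * Complex.I : ℂ) ^ (-(s : ℂ))) := by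
    refine Integrable.const_mul ?_ _
    refine (aux_bound_integrable s hs).mono' (aux_cont s).aestronglyMeasurable ?_
    exact Eventually.of_forall fun y => (aux_norm s y).le
  have hpi := Real.pi_pos
  have hFi : Integrable (𝓕 f) := by
    rw [hF]
    exact hGi.comp_mul_left' (R := -2 * Real.pi) (by linarith [hpi] : (-2 * Real.pi : ℝ) ≠ 0)
  have hinv := congrFun (hfc.fourierInv_fourier_eq hfi hFi) c
  rw [Real.fourierInv_eq', hF] at hinv
  have key := Measure.integral_comp_mul_left (fun u : ℝ => Complex.exp (-(c * u * Complex.I)) *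
    ((Real.Gamma s : ℂ) * (1 - u * Complex.I : ℂ) ^ (-(s : ℂ)))) (-2 * Real.pi)
  have h3 : ∫ (v : ℝ), Complex.exp (↑(2 * Real.pi * inner ℝ v c) * Complex.I) •
      ((Real.Gamma s : ℂ) * (1 - ((-2 * Real.pi * v : ℝ) : ℂ) * Complex.I) ^ (-(s : ℂ))) =
      ∫ v : ℝ, Complex.exp (-(c * ((-2 * Real.pi * v : ℝ) : ℂ) * Complex.I)) *
    ((Real.Gamma s : ℂ) * (1 - ((-2 * Real.pi * v : ℝ) : ℂ) * Complex.I : ℂ) ^ (-(s : ℂ))) := by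
    congr 1; ext v
    rw [smul_eq_mul]
    congr 2
    simp; ring
  rw [h3, key] at hinv
  have hG : 0 < Real.Gamma s := Real.Gamma_pos_of_pos (by linarith)
  have h4 : ∫ y : ℝ, Complex.exp (c * (1 - y * Complex.I)) * (1 - y * Complex.I : ℂ) ^ (-(s : ℂ)) =
      (Complex.exp c / Real.Gamma s) * ∫ u : ℝ, Complex.exp (-(c * u * Complex.I)) *
    ((Real.Gamma s : ℂ) * (1 - u * Complex.I : ℂ) ^ (-(s : ℂ))) := by
    rw [← integral_const_mul]
    congr 1; ext u
    have : (c : ℂ) * (1 - u * Complex.I) = c + (-(c * u * Complex.I)) := by ring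
    rw [this, Complex.exp_add]
    have : (Real.Gamma s : ℂ) ≠ 0 := by exact_mod_cast hG.ne'
    field_simp
  rw [h4]
  have h5 : |(-2 * Real.pi)⁻¹| = (2 * Real.pi)⁻¹ := by
    rw [abs_inv, abs_mul, abs_of_pos hpi]; norm_num
  rw [h5, Complex.real_smul] at hinv
  have hpc : (Real.pi : ℂ) ≠ 0 := by exact_mod_cast hpi.ne'
  have h6 : ∫ u : ℝ, Complex.exp (-(c * u * Complex.I)) *
    ((Real.Gamma s : ℂ) * (1 - u * Complex.I : ℂ) ^ (-(s : ℂ))) = 2 * Real.pi * f c := by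
    rw [← hinv, ← mul_assoc]
    have : (2 * Real.pi : ℂ) * (((2 * Real.pi)⁻¹ : ℝ) : ℂ) = 1 := by push_cast; field_simp
    rw [this, one_mul]
  rw [h6, hf]
  simp only [max_eq_left hc.le, Complex.ofReal_mul, Complex.ofReal_exp, Complex.ofReal_neg,
    Complex.ofReal_div, Complex.exp_neg]
  have := Complex.exp_ne_zero c
  push_cast
  field_simp

/-- the rescaled point on the contour -/
def zpt (N : ℕ) (y : ℝ) : ℂ := ((1 - 1 / (N : ℝ) : ℝ) : ℂ) * Complex.exp (((y / N : ℝ) : ℂ) * Complex.I)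

/-- the rescaled integrand -/
def Gf (s x : ℝ) (N : ℕ) (y : ℝ) : ℂ :=
  ((N : ℝ) * (1 - zpt N y) : ℂ) ^ (-(s : ℂ)) *
    Complex.exp (-(1 / 4 : ℂ) * ((x : ℝ) : ℂ) ^ 2 * (1 - zpt N y)) * (zpt N y ^ N)⁻¹

lemma zpt_norm (N : ℕ) (hN : 2 ≤ N) (y : ℝ) : ‖zpt N y‖ = 1 - 1 / (N : ℝ) := by
  have hN' : (2 : ℝ) ≤ N := by exact_mod_cast hN
  have : 1 / (N : ℝ) ≤ 1 / 2 := one_div_le_one_div_of_le (by norm_num) hN'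
  rw [zpt, norm_mul, Complex.norm_exp_ofReal_mul_I, mul_one, Complex.norm_real,
    Real.norm_of_nonneg (by linarith)]

lemma zpt_ne (N : ℕ) (hN : 2 ≤ N) (y : ℝ) : zpt N y ≠ 0 := by
  have hN' : (2 : ℝ) ≤ N := by exact_mod_cast hN
  have : 1 / (N : ℝ) ≤ 1 / 2 := one_div_le_one_div_of_le (by norm_num) hN'
  rw [← norm_pos_iff, zpt_norm N hN]; linarith

lemma zpt_re (N : ℕ) (hN : 2 ≤ N) (y : ℝ) : (zpt N y).re < 1 := by
  have hN' : (2 : ℝ) ≤ N := by exact_mod_cast hN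
  have : 0 < 1 / (N : ℝ) := by positivity
  have := (Complex.re_le_norm (zpt N y)).trans_eq (zpt_norm N hN y)
  linarith

lemma real_mul_cpow_aux (a : ℝ) (ha : 0 < a) (w : ℂ) (hw : w ≠ 0) (p : ℂ) :
    ((a : ℂ) * w) ^ p = (a : ℂ) ^ p * w ^ p := by
  have hac : (a : ℂ) ≠ 0 := by exact_mod_cast ha.ne'
  rw [Complex.cpow_def_of_ne_zero (mul_ne_zero hac hw), Complex.cpow_def_of_ne_zero hac,
    Complex.cpow_def_of_ne_zero hw, Complex.log_ofReal_mul ha hw, ← Complex.exp_add,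
    Complex.ofReal_log ha.le]
  congr 1; ring

lemma circle_rescale (s x : ℝ) (N : ℕ) (hN : 2 ≤ N) :
    (∮ z in C((0 : ℂ), 1 - 1 / (N : ℝ)),
        Complex.exp (-(1 / 4 : ℂ) * ((x : ℝ) : ℂ) ^ 2 * (1 - z)) /
          ((1 - z) ^ (s : ℂ) * z ^ (N + 1))) =
      Complex.I * (((N : ℝ) ^ (s - 1) : ℝ) : ℂ) *
        ∫ y : ℝ, (Set.Ioc (-(Real.pi * N)) (Real.pi * N)).indicator (Gf s x N) y := by
  have hN0 : (0 : ℝ) < N := by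
    have : 0 < N := by omega
    exact_mod_cast this
  have hpi := Real.pi_pos
  set g : ℝ → ℂ := fun θ => deriv (circleMap (0 : ℂ) (1 - 1 / (N : ℝ))) θ •
    (Complex.exp (-(1 / 4 : ℂ) * ((x : ℝ) : ℂ) ^ 2 * (1 - circleMap 0 (1 - 1 / (N : ℝ)) θ)) /
          ((1 - circleMap 0 (1 - 1 / (N : ℝ)) θ) ^ (s : ℂ) *
            circleMap 0 (1 - 1 / (N : ℝ)) θ ^ (N + 1))) with hg
  have hper : Function.Periodic g (2 * Real.pi) := by
    intro θ
    simp only [hg, deriv_circleMap, periodic_circleMap (0 : ℂ) (1 - 1 / (N : ℝ)) θ]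
  have h1 : (∮ z in C((0 : ℂ), 1 - 1 / (N : ℝ)),
        Complex.exp (-(1 / 4 : ℂ) * ((x : ℝ) : ℂ) ^ 2 * (1 - z)) /
          ((1 - z) ^ (s : ℂ) * z ^ (N + 1))) = ∫ θ in (0 : ℝ)..(2 * Real.pi), g θ := rfl
  have h2 := hper.intervalIntegral_add_eq 0 (-Real.pi)
  rw [zero_add, show -Real.pi + 2 * Real.pi = Real.pi by ring] at h2
  have h3 := intervalIntegral.integral_comp_div (a := -(Real.pi * N)) (b := Real.pi * N) g hN0.ne'
  rw [neg_div, mul_div_cancel_right₀ _ hN0.ne', intervalIntegral.integral_of_le (by nlinarith),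
    ← integral_indicator measurableSet_Ioc] at h3
  have h4 : ∀ y : ℝ, g (y / N) = Complex.I * (((N : ℝ) ^ s : ℝ) : ℂ) * Gf s x N y := by
    intro y
    have hz : circleMap 0 (1 - 1 / (N : ℝ)) (y / N) = zpt N y := by
      simp [circleMap, zpt]
    have hz0 := zpt_ne N hN y
    have hr := zpt_re N hN y
    have hw : (1 - zpt N y) ≠ 0 := by
      intro h
      have := congrArg Complex.re h
      simp at this; linarith
    simp only [hg, deriv_circleMap, hz, Gf, smul_eq_mul]
    rw [← Complex.ofReal_neg, real_mul_cpow_aux _ hN0 _ hw]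
    rw [← Complex.ofReal_cpow hN0.le, Real.rpow_neg hN0.le, Complex.ofReal_neg, Complex.cpow_neg]
    have : (((N : ℝ) ^ s : ℝ) : ℂ) ≠ 0 := by
      have := Real.rpow_pos_of_pos hN0 s
      exact_mod_cast this.ne'
    have h7 : (1 - zpt N y) ^ (s : ℂ) ≠ 0 := by
      rw [Ne, Complex.cpow_eq_zero_iff]; tauto
    push_cast
    field_simp
    ring
  have h5 : (fun y => (Set.Ioc (-(Real.pi * N)) (Real.pi * N)).indicator (fun y => g (y / N)) y) =
      fun y => Complex.I * (((N : ℝ) ^ s : ℝ) : ℂ) *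
        (Set.Ioc (-(Real.pi * N)) (Real.pi * N)).indicator (Gf s x N) y := by
    ext y
    by_cases hy : y ∈ Set.Ioc (-(Real.pi * N)) (Real.pi * N)
    · simp only [Set.indicator_of_mem hy, h4]
    · simp [Set.indicator_of_notMem hy]
  rw [h5, integral_const_mul, Complex.real_smul] at h3
  rw [h1, h2]
  have hNc : ((N : ℝ) : ℂ) ≠ 0 := by exact_mod_cast hN0.ne'
  apply mul_left_cancel₀ hNc
  rw [← h3, Real.rpow_sub_one hN0.ne']
  push_cast
  push_cast at hNc
  field_simp

lemma Gf_bound (s x : ℝ) (hs : 0 < s) (N : ℕ) (hN : 2 ≤ N)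
    (h3 : (((1 - 1 / (N : ℝ)) ^ N)⁻¹) ≤ 3) (y : ℝ)
    (hy : y ∈ Set.Ioc (-(Real.pi * N)) (Real.pi * N)) :
    ‖Gf s x N y‖ ≤ 3 * ((1 + y ^ 2) / 5) ^ (-s / 2) := by
  have hN' : (2 : ℝ) ≤ N := by exact_mod_cast hN
  have hN0 : (0 : ℝ) < N := by linarith
  have hi : 1 / (N : ℝ) ≤ 1 / 2 := one_div_le_one_div_of_le (by norm_num) hN'
  have hre := zpt_re N hN y
  rw [Gf, norm_mul, norm_mul, norm_inv, norm_pow, zpt_norm N hN, ← Complex.ofReal_neg,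
    Complex.norm_cpow_real]
  have hexp : ‖Complex.exp (-(1 / 4 : ℂ) * ((x : ℝ) : ℂ) ^ 2 * (1 - zpt N y))‖ ≤ 1 := by
    rw [Complex.norm_exp, Real.exp_le_one_iff]
    have : -(1 / 4 : ℂ) * ((x : ℝ) : ℂ) ^ 2 * (1 - zpt N y) =
      ((-(1 / 4) * x ^ 2 : ℝ) : ℂ) * (1 - zpt N y) := by push_cast; ring
    rw [this, Complex.re_ofReal_mul]
    simp only [Complex.sub_re, Complex.one_re]
    nlinarith [mul_nonneg (sq_nonneg x) (by linarith : 0 ≤ 1 - (zpt N y).re)]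
  have hlow : (1 + y ^ 2) / 5 ≤ ‖((N : ℝ) * (1 - zpt N y) : ℂ)‖ ^ 2 := by
    have hcos := Real.cos_le_one_sub_mul_cos_sq (x := y / N) (by
      rw [abs_le, div_le_iff₀ hN0, le_div_iff₀ hN0]
      constructor
      · linarith [hy.1]
      · exact hy.2)
    rw [norm_mul, Complex.norm_real, mul_pow, Real.norm_of_nonneg hN0.le, Complex.sq_norm,
      Complex.normSq_apply]
    have hzr : (1 - zpt N y).re = 1 - (1 - 1 / (N : ℝ)) * Real.cos (y / N) := by
      rw [zpt, Complex.sub_re, Complex.re_ofReal_mul, Complex.exp_ofReal_mul_I_re, Complex.one_re]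
    have hzi : (1 - zpt N y).im = - ((1 - 1 / (N : ℝ)) * Real.sin (y / N)) := by
      rw [zpt, Complex.sub_im, Complex.im_ofReal_mul, Complex.exp_ofReal_mul_I_im, Complex.one_im,
        zero_sub]
    rw [hzr, hzi]
    set C := Real.cos (y / N)
    set S := Real.sin (y / N)
    have hCS : S ^ 2 + C ^ 2 = 1 := Real.sin_sq_add_cos_sq _
    set r := 1 - 1 / (N : ℝ) with hr
    have e1 : (1 - r * C) * (1 - r * C) + -(r * S) * -(r * S) = (1 - r) ^ 2 + 2 * r * (1 - C) := by
      have : S ^ 2 = 1 - C ^ 2 := by linarith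
      ring_nf
      rw [this]; ring
    rw [e1]
    have e2 : (N : ℝ) ^ 2 * (1 - r) ^ 2 = 1 := by rw [hr]; field_simp; ring
    have hpi2 : Real.pi ^ 2 < 10 := by nlinarith [Real.pi_lt_d2, Real.pi_pos]
    have e3 : (1 / 5) * (y / N) ^ 2 ≤ 1 - C := by
      have : (1 / 5 : ℝ) ≤ 2 / Real.pi ^ 2 := by
        rw [div_le_div_iff₀ (by norm_num) (by positivity)]; linarith
      nlinarith [mul_le_mul_of_nonneg_right this (sq_nonneg (y / N))]
    have e4 : (1 / 5) * (y / N) ^ 2 ≤ 2 * r * (1 - C) := by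
      have h0 : 0 ≤ 1 - C := le_trans (by positivity) e3
      nlinarith
    have e5 : (N : ℝ) ^ 2 * ((1 / 5) * (y / N) ^ 2) = y ^ 2 / 5 := by field_simp
    have e6 := mul_le_mul_of_nonneg_left e4 (sq_nonneg (N : ℝ))
    nlinarith
  have hpow : ‖((N : ℝ) * (1 - zpt N y) : ℂ)‖ ^ (-s) ≤ ((1 + y ^ 2) / 5) ^ (-s / 2) := by
    have : ‖((N : ℝ) * (1 - zpt N y) : ℂ)‖ ^ (-s) =
        (‖((N : ℝ) * (1 - zpt N y) : ℂ)‖ ^ 2) ^ (-s / 2) := by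
      rw [← Real.rpow_natCast, ← Real.rpow_mul (norm_nonneg _)]
      congr 1; push_cast; ring
    rw [this]
    exact Real.rpow_le_rpow_of_nonpos (by positivity) hlow (by linarith)
  have hpos : 0 ≤ ((1 + y ^ 2) / 5) ^ (-s / 2) := by positivity
  have hr0 : 0 ≤ 1 - 1 / (N : ℝ) := by linarith
  have hr1 : 0 ≤ ((1 - 1 / (N : ℝ)) ^ N)⁻¹ := by positivity
  calc _ ≤ ((1 + y ^ 2) / 5) ^ (-s / 2) * 1 * 3 := by gcongr
    _ = _ := by ring

lemma tendsto_rpow_e : Tendsto (fun N : ℕ => (1 - 1 / (N : ℝ)) ^ N) atTop (nhds (Real.exp (-1))) := by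
  have := Real.tendsto_one_add_div_pow_exp (-1)
  refine this.congr fun N => ?_
  congr 1; ring

lemma zpt_tendsto (y : ℝ) :
    Tendsto (fun N : ℕ => ((N : ℝ) * (1 - zpt N y) : ℂ)) atTop (nhds (1 - y * Complex.I)) := by
  have hd : HasDerivAt (fun t : ℝ => Complex.exp ((t : ℂ) * (y * Complex.I)))
      (y * Complex.I) 0 := by
    have h1 : HasDerivAt (fun t : ℝ => (t : ℂ) * (y * Complex.I)) (1 * (y * Complex.I)) 0 :=
      (Complex.ofRealCLM.hasDerivAt (x := (0 : ℝ))).mul_const (y * Complex.I : ℂ)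
    simpa using h1.cexp
  have hinv : Tendsto (fun N : ℕ => ((N : ℝ))⁻¹) atTop (nhdsWithin 0 {(0 : ℝ)}ᶜ) := by
    rw [tendsto_nhdsWithin_iff]
    refine ⟨tendsto_inv_atTop_nhds_zero_nat, ?_⟩
    filter_upwards [eventually_gt_atTop 0] with N hN
    have : (N : ℝ) ≠ 0 := by exact_mod_cast hN.ne'
    simpa using hN.ne'
  have h2 := hd.tendsto_slope_zero.comp hinv
  have h3 : Tendsto (fun N : ℕ => Complex.exp ((((N : ℝ)⁻¹ : ℝ) : ℂ) * (y * Complex.I))) atTop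
      (nhds 1) := by
    have := hd.continuousAt.tendsto.comp (hinv.mono_right nhdsWithin_le_nhds)
    simpa [Function.comp_def] using this
  have h4 := h3.sub h2
  refine h4.congr' ?_
  filter_upwards [eventually_gt_atTop 0] with N hN
  have hNc : (N : ℂ) ≠ 0 := by exact_mod_cast hN.ne'
  have e : ((y / N : ℝ) : ℂ) * Complex.I = (((N : ℝ)⁻¹ : ℝ) : ℂ) * (y * Complex.I) := by
    push_cast; ring
  simp only [Function.comp_apply, zpt, e, inv_inv, zero_add, Complex.real_smul]
  generalize Complex.exp ((((N : ℝ)⁻¹ : ℝ) : ℂ) * (y * Complex.I)) = E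
  simp only [Complex.ofReal_zero, zero_mul, Complex.exp_zero]
  push_cast
  field_simp
  ring

lemma Gf_tendsto (s ξ : ℝ) (ξseq : ℕ → ℝ)
    (hconv : Tendsto (fun N : ℕ => ξseq N / Real.sqrt N) atTop (nhds ξ)) (y : ℝ) :
    Tendsto (fun N : ℕ => Gf s (ξseq N) N y) atTop
      (nhds (Complex.exp (((1 - ξ ^ 2 / 4 : ℝ) : ℂ) * (1 - y * Complex.I)) *
        (1 - y * Complex.I : ℂ) ^ (-(s : ℂ)))) := by
  have hz := zpt_tendsto y
  have h1 : Tendsto (fun N : ℕ => ((N : ℝ) * (1 - zpt N y) : ℂ) ^ (-(s : ℂ))) atTop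
      (nhds ((1 - y * Complex.I : ℂ) ^ (-(s : ℂ)))) := by
    refine (continuousAt_cpow_const ?_).tendsto.comp hz
    left; simp
  have h2 : Tendsto (fun N : ℕ =>
      Complex.exp (-(1 / 4 : ℂ) * ((ξseq N : ℝ) : ℂ) ^ 2 * (1 - zpt N y))) atTop
      (nhds (Complex.exp (-(1 / 4 : ℂ) * (ξ : ℂ) ^ 2 * (1 - y * Complex.I)))) := by
    have hx : Tendsto (fun N : ℕ => ((ξseq N / Real.sqrt N : ℝ) : ℂ)) atTop (nhds (ξ : ℂ)) :=
      (Complex.continuous_ofReal.tendsto _).comp hconv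
    have h := (Complex.continuous_exp.tendsto _).comp (((hx.pow 2).const_mul (-(1 / 4 : ℂ))).mul hz)
    refine h.congr' ?_
    filter_upwards [eventually_gt_atTop 0] with N hN
    have hNc : (N : ℂ) ≠ 0 := by exact_mod_cast hN.ne'
    simp only [Function.comp_apply]
    congr 1
    have : ((Real.sqrt N : ℝ) : ℂ) ^ 2 = N := by
      rw [← Complex.ofReal_pow, Real.sq_sqrt (by positivity)]; simp
    push_cast
    rw [div_pow, this]
    field_simp
  have h3 : Tendsto (fun N : ℕ => (zpt N y ^ N)⁻¹) atTop
      (nhds (((Real.exp (-1) : ℝ) * Complex.exp (y * Complex.I) : ℂ)⁻¹)) := by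
    refine Tendsto.inv₀ ?_ ?_
    · have : Tendsto (fun N : ℕ => (((1 - 1 / (N : ℝ)) ^ N : ℝ) : ℂ)) atTop
          (nhds ((Real.exp (-1) : ℝ) : ℂ)) :=
        (Complex.continuous_ofReal.tendsto _).comp tendsto_rpow_e
      refine (this.mul_const _).congr' ?_
      filter_upwards [eventually_gt_atTop 0] with N hN
      have hNc : (N : ℂ) ≠ 0 := by exact_mod_cast hN.ne'
      rw [zpt, mul_pow, ← Complex.exp_nat_mul, Complex.ofReal_pow]
      congr 2
      push_cast; field_simp
    · refine mul_ne_zero ?_ (Complex.exp_ne_zero _)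
      exact_mod_cast (Real.exp_pos _).ne'
  have h := (h1.mul h2).mul h3
  have e : Complex.exp (((1 - ξ ^ 2 / 4 : ℝ) : ℂ) * (1 - y * Complex.I)) *
        (1 - y * Complex.I : ℂ) ^ (-(s : ℂ)) = (1 - y * Complex.I : ℂ) ^ (-(s : ℂ)) *
        Complex.exp (-(1 / 4 : ℂ) * (ξ : ℂ) ^ 2 * (1 - y * Complex.I)) *
        ((Real.exp (-1) : ℝ) * Complex.exp (y * Complex.I) : ℂ)⁻¹ := by
    rw [Complex.ofReal_exp, ← Complex.exp_add, ← Complex.exp_neg, mul_assoc, ← Complex.exp_add,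
      mul_comm]
    congr 2
    push_cast; ring
  rw [e]
  exact h

lemma integral_Gf_tendsto (s ξ : ℝ) (hs : 1 < s) (hξ : ξ ∈ Set.Ioo (-2 : ℝ) 2) (ξseq : ℕ → ℝ)
    (hconv : Tendsto (fun N : ℕ => ξseq N / Real.sqrt N) atTop (nhds ξ)) :
    Tendsto (fun N : ℕ => ∫ y : ℝ,
        (Set.Ioc (-(Real.pi * N)) (Real.pi * N)).indicator (Gf s (ξseq N) N) y) atTop
      (nhds ((2 * Real.pi * (1 - ξ ^ 2 / 4) ^ (s - 1) / Real.Gamma s : ℝ) : ℂ)) := by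
  have hc : 0 < 1 - ξ ^ 2 / 4 := by nlinarith [hξ.1, hξ.2]
  rw [← aux_hankel s _ hs hc]
  refine tendsto_integral_filter_of_dominated_convergence
    (fun y => 3 * ((1 + y ^ 2) / 5) ^ (-s / 2)) ?_ ?_ ?_ ?_
  · refine Eventually.of_forall fun N => ?_
    refine (Measurable.indicator ?_ measurableSet_Ioc).aestronglyMeasurable
    unfold Gf zpt
    fun_prop
  · have hlim := tendsto_rpow_e.inv₀ (Real.exp_pos _).ne'
    have hlt : (Real.exp (-1))⁻¹ < 3 := by
      rw [← Real.exp_neg, neg_neg]; linarith [Real.exp_one_lt_d9]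
    filter_upwards [hlim.eventually (gt_mem_nhds hlt), eventually_ge_atTop 2] with N h3 hN
    refine Eventually.of_forall fun y => ?_
    by_cases hy : y ∈ Set.Ioc (-(Real.pi * N)) (Real.pi * N)
    · rw [Set.indicator_of_mem hy]
      exact Gf_bound s _ (by linarith) N hN h3.le y hy
    · rw [Set.indicator_of_notMem hy, norm_zero]
      positivity
  · refine Integrable.const_mul ?_ _
    refine ((aux_bound_integrable s hs).div_const ((5 : ℝ) ^ (-s / 2))).congr ?_
    refine Eventually.of_forall fun y => ?_
    exact (Real.div_rpow (by positivity) (by norm_num) _).symm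
  · refine Eventually.of_forall fun y => ?_
    refine (Gf_tendsto s ξ ξseq hconv y).congr' ?_
    have h := (tendsto_natCast_atTop_atTop (R := ℝ)).const_mul_atTop Real.pi_pos
    filter_upwards [h.eventually_gt_atTop |y|] with N hN
    rw [abs_lt] at hN
    have hy : y ∈ Set.Ioc (-(Real.pi * N)) (Real.pi * N) := ⟨hN.1, hN.2.le⟩
    rw [Set.indicator_of_mem hy]

lemma const_eq (l : ℕ) (ξ : ℝ) (hξ : ξ ∈ Set.Ioo (-2 : ℝ) 2) :
    (1 - ξ ^ 2 / 4) ^ ((l : ℝ) + 1 / 2) / (l ! * Real.Gamma ((l : ℝ) + 3 / 2)) =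
      1 / Real.sqrt Real.pi * (1 / (2 * l + 1)!) * (4 - ξ ^ 2) ^ ((l : ℝ) + 1 / 2) := by
  have hc : 0 < 4 - ξ ^ 2 := by nlinarith [hξ.1, hξ.2]
  have h := Real.Gamma_mul_Gamma_add_half ((l : ℝ) + 1)
  have e1 : Real.Gamma (2 * ((l : ℝ) + 1)) = ((2 * l + 1)! : ℝ) := by
    rw [← Real.Gamma_nat_eq_factorial]; congr 1; push_cast; ring
  rw [Real.Gamma_nat_eq_factorial, e1, show (l : ℝ) + 1 + 1 / 2 = l + 3 / 2 by ring] at h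
  rw [h, show 1 - ξ ^ 2 / 4 = (4 - ξ ^ 2) / 4 by ring, Real.div_rpow hc.le (by norm_num)]
  have e2 : (4 : ℝ) ^ ((l : ℝ) + 1 / 2) = (2 : ℝ) ^ (2 * (l : ℝ) + 1) := by
    rw [show (4 : ℝ) = 2 ^ (2 : ℝ) by norm_num, ← Real.rpow_mul (by norm_num)]
    congr 1; ring
  have e3 : (2 : ℝ) ^ (1 - 2 * ((l : ℝ) + 1)) = ((2 : ℝ) ^ (2 * (l : ℝ) + 1))⁻¹ := by
    rw [← Real.rpow_neg (by norm_num)]; congr 1; ring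
  rw [e2, e3]
  have : 0 < (2 : ℝ) ^ (2 * (l : ℝ) + 1) := by positivity
  have hp : 0 < Real.sqrt Real.pi := Real.sqrt_pos.2 Real.pi_pos
  have hf : (((2 * l + 1)! : ℕ) : ℝ) ≠ 0 := by exact_mod_cast (Nat.factorial_pos _).ne'
  field_simp

/-- limit (3.8) of the paper: let `ξ ∈ (-2,2)`, let `(ξ_N)` be reals with
`ξ_N/√N → ξ`, and let `η ∈ ℂ`. Then for every `l ∈ ℕ`,
`((-1)^l η^{2l})/(l! N^{l+1/2}) · (1/(2πi)) ∮_{γ_N} exp(-¼ ξ_N² (1-z)) / (1-z)^{l+3/2} · dz/z^{N+1}`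
converges to `(1/√π) · ((-1)^l η^{2l})/((2l+1)!) · (4-ξ²)^{l+1/2}`, where `γ_N` is the
counterclockwise circle of radius `1 - 1/N` about the origin and `(1-z)^{l+3/2}` is the
principal branch. -/
theorem circleIntegral_term_limit
    (ξ : ℝ) (hξ : ξ ∈ Set.Ioo (-2 : ℝ) 2)
    (ξseq : ℕ → ℝ)
    (hconv : Tendsto (fun N : ℕ => ξseq N / Real.sqrt N) atTop (nhds ξ))
    (η : ℂ) (l : ℕ) :
    Tendsto (fun N : ℕ =>
        (((-1 : ℂ) ^ l * η ^ (2 * l)) /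
            ((l ! : ℂ) * (((N : ℝ) ^ ((l : ℝ) + 1 / 2) : ℝ) : ℂ))) *
          ((1 / (2 * Real.pi * Complex.I)) *
            ∮ z in C((0 : ℂ), 1 - 1 / (N : ℝ)),
              Complex.exp (-(1 / 4 : ℂ) * ((ξseq N : ℝ) : ℂ) ^ 2 * (1 - z)) /
                ((1 - z) ^ ((l : ℂ) + 3 / 2) * z ^ (N + 1))))
      atTop
      (nhds (((1 / Real.sqrt Real.pi : ℝ) : ℂ) *
        (((-1 : ℂ) ^ l * η ^ (2 * l)) / ((2 * l + 1)! : ℂ)) *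
        ((((4 - ξ ^ 2 : ℝ) ^ ((l : ℝ) + 1 / 2) : ℝ)) : ℂ))) := by
  have hI := integral_Gf_tendsto ((l : ℝ) + 3 / 2) ξ
    (by have : (0 : ℝ) ≤ l := by positivity
        linarith) hξ ξseq hconv
  have hpi := Real.pi_pos
  have hpc : (Real.pi : ℂ) ≠ 0 := by exact_mod_cast hpi.ne'
  have h := hI.const_mul ((((-1 : ℂ) ^ l * η ^ (2 * l)) / (l ! : ℂ)) * (1 / (2 * Real.pi)))
  have hlf : (l ! : ℂ) ≠ 0 := by exact_mod_cast (Nat.factorial_pos _).ne'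
  have hlim : (((-1 : ℂ) ^ l * η ^ (2 * l)) / (l ! : ℂ)) * (1 / (2 * Real.pi)) *
      ((2 * Real.pi * (1 - ξ ^ 2 / 4) ^ ((l : ℝ) + 3 / 2 - 1) / Real.Gamma ((l : ℝ) + 3 / 2) : ℝ) : ℂ)
      = ((1 / Real.sqrt Real.pi : ℝ) : ℂ) *
        (((-1 : ℂ) ^ l * η ^ (2 * l)) / ((2 * l + 1)! : ℂ)) *
        ((((4 - ξ ^ 2 : ℝ) ^ ((l : ℝ) + 1 / 2) : ℝ)) : ℂ) := by
    have e := congrArg (fun t : ℝ => (t : ℂ)) (const_eq l ξ hξ)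
    rw [show (l : ℝ) + 3 / 2 - 1 = l + 1 / 2 by ring]
    generalize (1 - ξ ^ 2 / 4) ^ ((l : ℝ) + 1 / 2) = a at *
    generalize (4 - ξ ^ 2) ^ ((l : ℝ) + 1 / 2) = b at *
    generalize Real.Gamma ((l : ℝ) + 3 / 2) = c at *
    generalize (-1 : ℂ) ^ l * η ^ (2 * l) = K at *
    simp only [Complex.ofReal_div, Complex.ofReal_mul, Complex.ofReal_natCast, Complex.ofReal_one,
      Complex.ofReal_ofNat] at e ⊢
    calc K / (l ! : ℂ) * (1 / (2 * Real.pi)) * (2 * Real.pi * a / c) = K * (a / (l ! * c)) := by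
          field_simp
      _ = _ := by rw [e]; ring
  rw [hlim] at h
  refine h.congr' ?_
  filter_upwards [eventually_ge_atTop 2] with N hN
  have hs : (l : ℂ) + 3 / 2 = (((l : ℝ) + 3 / 2 : ℝ) : ℂ) := by push_cast; ring
  rw [hs, circle_rescale _ _ N hN, show (l : ℝ) + 3 / 2 - 1 = l + 1 / 2 by ring]
  have hN0 : (0 : ℝ) < N := by
    have : 0 < N := by omega
    exact_mod_cast this
  have hNp : (((N : ℝ) ^ ((l : ℝ) + 1 / 2) : ℝ) : ℂ) ≠ 0 := by
    exact_mod_cast (Real.rpow_pos_of_pos hN0 _).ne'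
  generalize (((N : ℝ) ^ ((l : ℝ) + 1 / 2) : ℝ) : ℂ) = M at *
  generalize (∫ y : ℝ, _ : ℂ) = J
  have := Complex.I_ne_zero
  field_simp
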